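/- arXiv:2406.09816 — 2 statements merged into one kernel-verified Lean document; each statement's English description precedes it below -/
import Mathlib

section
/- Let f : ℝ^d → ℝ be differentiable with L-Lipschitz gradient, let c ∈ (0,1) be the Armijo parameter and γ₀ ∈ (0,1) the backtracking factor. Let sequences {x^k} ⊆ ℝ^d, {d^k} ⊆ ℝ^d and stepsizes {α^k} ⊆ (0,1] satisfy: x^{k+1} = x^k + α^k d^k; ⟨∇f(x^k), d^k⟩ ≤ 0 for all k; the Armijo condition f(x^k + α^k d^k) ≤ f(x^k) + c α^k ⟨∇f(x^k), d^k⟩ holds for all k; and for every k with α^k < 1 the Armijo condition fails at the trial stepsize α^k/γ₀, i.e. f(x^k + (α^k/γ₀) d^k) − f(x^k) > c (α^k/γ₀) ⟨∇f(x^k), d^k⟩. Then at least one of the following holds: (i) f(x^k) → −∞ as k → ∞; (ii) the sequence {‖d^k‖} is unbounded; (iii) for every infinite subset J ⊆ ℕ for which {d^k : k ∈ J} is bounded, ⟨∇f(x^k), d^k⟩ → 0 as k → ∞ along k ∈ J. -/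
open Filter
open scoped RealInnerProductSpace

/-- Upper bound on the increase of a function with Lipschitz gradient along a segment. -/
lemma sub_le_of_lipschitz_gradient {E : Type*} [NormedAddCommGroup E] [InnerProductSpace ℝ E]
    [CompleteSpace E] {f : E → ℝ} (hf : Differentiable ℝ f) {L : ℝ}
    (hL : ∀ x y, ‖gradient f x - gradient f y‖ ≤ L * ‖x - y‖) (x v : E) {t : ℝ} (ht : 0 < t) :
    f (x + t • v) - f x ≤ t * ⟪gradient f x, v⟫ + |L| * t ^ 2 * ‖v‖ ^ 2 := by
  have hline : ∀ s : ℝ, HasDerivAt (fun s : ℝ => f (x + s • v)) ⟪gradient f (x + s • v), v⟫ s := by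
    intro s
    have h1 : HasDerivAt (fun s : ℝ => x + s • v) v s := by
      simpa using ((hasDerivAt_id s).smul_const v).const_add x
    exact (hf (x + s • v)).hasGradientAt.hasFDerivAt.comp_hasDerivAt s h1
  obtain ⟨s, ⟨hs0, hst⟩, hs⟩ := exists_hasDerivAt_eq_slope _ _ ht
    (fun s _ => (hline s).continuousAt.continuousWithinAt) (fun s _ => hline s)
  have hslope : f (x + t • v) - f x = t * ⟪gradient f (x + s • v), v⟫ := by
    rw [hs]
    simp only [zero_smul, add_zero, sub_zero]
    field_simp
  have hgrad : ‖gradient f (x + s • v) - gradient f x‖ ≤ |L| * (t * ‖v‖) := by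
    calc _ ≤ L * ‖x + s • v - x‖ := hL _ _
      _ = L * (s * ‖v‖) := by rw [add_sub_cancel_left, norm_smul, Real.norm_of_nonneg hs0.le]
      _ ≤ |L| * (t * ‖v‖) := by gcongr; exact le_abs_self L
  have hinner : ⟪gradient f (x + s • v), v⟫ - ⟪gradient f x, v⟫ ≤ |L| * (t * ‖v‖) * ‖v‖ := by
    rw [← inner_sub_left]
    exact (real_inner_le_norm _ _).trans (by gcongr)
  rw [hslope]
  nlinarith [mul_le_mul_of_nonneg_left hinner ht.le]

/-- If the Armijo condition fails at a positive stepsize, then the directional derivative is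
controlled by that stepsize. -/
lemma neg_inner_gradient_le_of_armijo_fails {E : Type*} [NormedAddCommGroup E]
    [InnerProductSpace ℝ E] [CompleteSpace E] {f : E → ℝ} (hf : Differentiable ℝ f) {L : ℝ}
    (hL : ∀ x y, ‖gradient f x - gradient f y‖ ≤ L * ‖x - y‖) {x v : E} {c t : ℝ} (ht : 0 < t)
    (hfail : c * t * ⟪gradient f x, v⟫ < f (x + t • v) - f x) :
    (1 - c) * -⟪gradient f x, v⟫ ≤ |L| * t * ‖v‖ ^ 2 := by
  have h := sub_le_of_lipschitz_gradient hf hL x v ht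
  refine le_of_mul_le_mul_left ?_ ht
  linarith

/-- Backtracking line search with the Armijo condition: for an `L`-smooth
`f` and iterates `x^{k+1} = x^k + α^k d^k` along descent directions, with stepsizes in
`(0,1]` accepted by the Armijo rule and such that the Armijo test fails at the trial
stepsize `α^k/γ₀` whenever `α^k < 1`, either `f(x^k) → -∞`, or `{‖d^k‖}` is unbounded,
or the directional derivatives `⟨∇f(x^k), d^k⟩` tend to `0` along every infinite index
set `J` on which `{d^k}` is bounded. -/
theorem stmt_0 {n : ℕ} (f : EuclideanSpace ℝ (Fin n) → ℝ) (hf : Differentiable ℝ f)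
    (L : ℝ) (hL : ∀ x y, ‖gradient f x - gradient f y‖ ≤ L * ‖x - y‖)
    (c γ₀ : ℝ) (hc0 : 0 < c) (hc1 : c < 1) (hγ0 : 0 < γ₀) (hγ1 : γ₀ < 1)
    (x dvec : ℕ → EuclideanSpace ℝ (Fin n)) (α : ℕ → ℝ)
    (hα : ∀ k, 0 < α k ∧ α k ≤ 1)
    (hupd : ∀ k, x (k + 1) = x k + α k • dvec k)
    (hdesc : ∀ k, ⟪gradient f (x k), dvec k⟫ ≤ 0)
    (harmijo : ∀ k, f (x k + α k • dvec k) ≤ f (x k) + c * α k * ⟪gradient f (x k), dvec k⟫)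
    (hfail : ∀ k, α k < 1 →
      f (x k + (α k / γ₀) • dvec k) - f (x k) > c * (α k / γ₀) * ⟪gradient f (x k), dvec k⟫) :
    Tendsto (fun k => f (x k)) atTop atBot ∨
      ¬ BddAbove (Set.range fun k => ‖dvec k‖) ∨
      ∀ J : Set ℕ, J.Infinite → Bornology.IsBounded (dvec '' J) →
        Tendsto (fun k => ⟪gradient f (x k), dvec k⟫) (atTop ⊓ 𝓟 J) (nhds 0) := by
  have hanti : Antitone fun k => f (x k) := by
    refine antitone_nat_of_succ_le fun k => ?_
    rw [hupd k]
    have := mul_nonneg (mul_nonneg hc0.le (hα k).1.le) (neg_nonneg.2 (hdesc k))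
    linarith [harmijo k]
  rcases tendsto_atTop_of_antitone hanti with hbot | ⟨l, hl⟩
  · exact Or.inl hbot
  refine Or.inr (or_iff_not_imp_left.2 fun hbdd J _ _ => Tendsto.mono_left ?_ inf_le_left)
  obtain ⟨D, hD⟩ := not_not.1 hbdd
  have hdD : ∀ k, ‖dvec k‖ ≤ D := fun k => hD ⟨k, rfl⟩
  set g : ℕ → ℝ := fun k => ⟪gradient f (x k), dvec k⟫
  have hu0 : ∀ k, 0 ≤ α k * -g k := fun k => mul_nonneg (hα k).1.le (neg_nonneg.2 (hdesc k))
  have hu : Tendsto (fun k => α k * -g k) atTop (nhds 0) := by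
    have hdiff : Tendsto (fun k => (f (x k) - f (x (k + 1))) / c) atTop (nhds 0) := by
      simpa using (hl.sub (hl.comp (tendsto_add_atTop_nat 1))).div_const c
    refine squeeze_zero hu0 (fun k => ?_) hdiff
    rw [le_div_iff₀ hc0, hupd k]
    linarith [harmijo k]
  set C : ℝ := |L| * D ^ 2 / (γ₀ * (1 - c)) with hC
  have hc : 0 < 1 - c := sub_pos.2 hc1
  have hC0 : 0 ≤ C := by positivity
  have hbound : ∀ k, -g k ≤ α k * -g k + √(C * (α k * -g k)) := by
    intro k
    rcases (hα k).2.eq_or_lt with h1 | h1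
    · rw [h1, one_mul]
      exact le_add_of_nonneg_right (Real.sqrt_nonneg _)
    · have hαγ : 0 < α k / γ₀ := div_pos (hα k).1 hγ0
      have hstep : -g k ≤ C * α k := by
        have h := neg_inner_gradient_le_of_armijo_fails hf hL hαγ (hfail k h1)
        have hle : |L| * (α k / γ₀) * ‖dvec k‖ ^ 2 ≤ |L| * (α k / γ₀) * D ^ 2 := by
          gcongr
          exact hdD k
        have heq : |L| * (α k / γ₀) * D ^ 2 = (1 - c) * (C * α k) := by
          rw [hC]
          field_simp
        exact le_of_mul_le_mul_left ((h.trans hle).trans_eq heq) hc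
      refine (Real.le_sqrt_of_sq_le ?_).trans (le_add_of_nonneg_left (hu0 k))
      have := mul_le_mul_of_nonneg_right hstep (neg_nonneg.2 (hdesc k))
      linarith
  have hlim : Tendsto (fun k => α k * -g k + √(C * (α k * -g k))) atTop (nhds 0) := by
    simpa using hu.add (hu.const_mul C).sqrt
  simpa only [neg_neg, neg_zero] using (squeeze_zero (fun k => neg_nonneg.2 (hdesc k)) hbound hlim).neg
end

section
/- Let d, N ∈ ℕ, θ ∈ (0,1], η > 1, ρ > 0, and 0 < m_i ≤ M_i for i = 1,…,N. Set Λ_m = diag(m_1,…,m_N) ⊗ I_d and Λ_M = diag(M_1,…,M_N) ⊗ I_d, and let W ∈ ℝ^{Nd×Nd} be symmetric positive semidefinite. Suppose the symmetric matrix D ∈ ℝ^{Nd×Nd} satisfies D ≻ Λ_M/(2η) + ρ(W + I_{Nd}) + (2/θ − 3/2)Λ_M − (3/2)Λ_m + ((1/θ)Λ_M − (Λ_M + Λ_m)/2)². Then for every symmetric H̃ ∈ ℝ^{Nd×Nd} with H̃ ⪰ (1/(2−θ))Λ_m, the matrix H̃ + D is positive definite. -/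
open Matrix
open scoped Kronecker

/-- The scalar form of the bound, with the curvature bounds `m ≤ M` of a single block. -/
lemma scalar_bound_nonneg {θ η m M : ℝ} (hθ0 : 0 < θ) (hθ1 : θ ≤ 1) (hη : 0 < η)
    (hm : 0 ≤ m) (hmM : m ≤ M) :
    0 ≤ (2 * η)⁻¹ * M + (2 / θ - 3 / 2) * M - 3 / 2 * m
      + (θ⁻¹ * M - 2⁻¹ * (M + m)) * (θ⁻¹ * M - 2⁻¹ * (M + m)) + (2 - θ)⁻¹ * m := by
  have hθ2 : 0 < 2 - θ := by linarith
  have hcoef : 0 ≤ 2 / θ - 3 + (2 - θ)⁻¹ := by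
    have h : 2 / θ - 3 + (2 - θ)⁻¹ = (1 - θ) * (4 - 3 * θ) / (θ * (2 - θ)) := by
      field_simp
      ring
    rw [h]
    exact div_nonneg (mul_nonneg (by linarith) (by linarith)) (by positivity)
  have hM : 0 ≤ (2 * η)⁻¹ * M := mul_nonneg (by positivity) (hm.trans hmM)
  have htwo : 2 ≤ 2 / θ := by rw [le_div_iff₀ hθ0]; linarith
  have hdiff : 0 ≤ (2 / θ - 3 / 2) * (M - m) := mul_nonneg (by linarith) (by linarith)
  have hmul : 0 ≤ (2 / θ - 3 + (2 - θ)⁻¹) * m := mul_nonneg hcoef hm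
  have hsq := mul_self_nonneg (θ⁻¹ * M - 2⁻¹ * (M + m))
  linarith

/-- If the symmetric block-diagonal matrix `D` satisfies the strict Loewner
inequality `D ≻ Λ_M/(2η) + ρ(W + I) + (2/θ - 3/2)Λ_M - (3/2)Λ_m + ((1/θ)Λ_M - (Λ_M+Λ_m)/2)²`,
then `H̃ + D` is positive definite for every symmetric `H̃ ⪰ (1/(2-θ))Λ_m`. -/
theorem stmt_9 {N d : ℕ} (θ η ρ : ℝ) (hθ0 : 0 < θ) (hθ1 : θ ≤ 1) (hη : 1 < η) (hρ : 0 < ρ)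
    (mv Mv : Fin N → ℝ) (hm : ∀ i, 0 < mv i) (hmM : ∀ i, mv i ≤ Mv i)
    (Λm ΛM W D : Matrix (Fin N × Fin d) (Fin N × Fin d) ℝ)
    (hΛm : Λm = Matrix.diagonal mv ⊗ₖ (1 : Matrix (Fin d) (Fin d) ℝ))
    (hΛM : ΛM = Matrix.diagonal Mv ⊗ₖ (1 : Matrix (Fin d) (Fin d) ℝ))
    (hW : W.PosSemidef) (hD : D.IsSymm)
    (hDbig : (D - ((2 * η)⁻¹ • ΛM + ρ • (W + 1) + (2 / θ - 3 / 2) • ΛM - (3 / 2 : ℝ) • Λm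
        + (θ⁻¹ • ΛM - (2 : ℝ)⁻¹ • (ΛM + Λm)) * (θ⁻¹ • ΛM - (2 : ℝ)⁻¹ • (ΛM + Λm)))).PosDef) :
    ∀ Ht : Matrix (Fin N × Fin d) (Fin N × Fin d) ℝ, Ht.IsSymm →
      (Ht - (2 - θ)⁻¹ • Λm).PosSemidef → (Ht + D).PosDef := by
  intro Ht _ hHt
  have hdiag : ((2 * η)⁻¹ • ΛM + (2 / θ - 3 / 2) • ΛM - (3 / 2 : ℝ) • Λm
      + (θ⁻¹ • ΛM - (2 : ℝ)⁻¹ • (ΛM + Λm)) * (θ⁻¹ • ΛM - (2 : ℝ)⁻¹ • (ΛM + Λm))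
      + (2 - θ)⁻¹ • Λm).PosSemidef := by
    rw [← diagonal_one, diagonal_kronecker_diagonal] at hΛm hΛM
    subst hΛm hΛM
    simp only [← diagonal_smul, diagonal_add, diagonal_sub, diagonal_mul_diagonal]
    refine PosSemidef.diagonal fun p => ?_
    simpa using scalar_bound_nonneg hθ0 hθ1 (by linarith) (hm p.1).le (hmM p.1)
  have hreg : (ρ • (W + 1)).PosSemidef := (hW.add PosSemidef.one).smul hρ.le
  convert hDbig.add_posSemidef ((hHt.add hdiag).add hreg) using 1
  abel
end
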